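/- Let Φ(0)=0 and let Φ* be strictly convex on (0,∞). Then for every F∈𝔽_{Φ*}, the mapping x ↦ φ_{Φ*}(F,x) has a unique minimizer in ℝ. -/

import Mathlib

open MeasureTheory ProbabilityTheory Filter Set
open scoped ENNReal NNReal

noncomputable section

/-- `ℝ^n` with the Euclidean metric. -/
abbrev Euc (n : ℕ) : Type := EuclideanSpace ℝ (Fin n)

/-- Left-continuous quantile function of a distribution function `F`. -/
def leftQuantile (F : ℝ → ℝ) (u : ℝ) : ℝ := sInf {t : ℝ | u ≤ F t}

/-- Objective function in the optimized-certainty-equivalent representation: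
`x ↦ ∫_(0,1) Φ*(F⁻(u)+x) du − x`. -/
def ocePhi (Φs : ℝ → ℝ) (F : ℝ → ℝ) (x : ℝ) : ℝ :=
  (∫ u in Set.Ioo (0:ℝ) 1, Φs (leftQuantile F u + x)) - x

/-- The functional `𝓡_{ρ^Φ}` associated with the divergence risk measure. -/
def RR (Φs : ℝ → ℝ) (F : ℝ → ℝ) : ℝ := ⨅ x : ℝ, ocePhi Φs F x

/-- `M_F`: the set of minimizers in the OCE representation. -/
def Mmin (Φs : ℝ → ℝ) (F : ℝ → ℝ) : Set ℝ :=
  {x : ℝ | ∀ y : ℝ, ocePhi Φs F x ≤ ocePhi Φs F y}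

/-- Empirical distribution function `F̂_{n,θ}` based on the sample `Z_1,…,Z_n`. -/
def empDF {Ω : Type*} {m d : ℕ} (G : Euc m → Euc d → ℝ) (Z : ℕ → Ω → Euc d)
    (θ : Euc m) (n : ℕ) (ω : Ω) (t : ℝ) : ℝ :=
  (n : ℝ)⁻¹ * ∑ j ∈ Finset.range n, (if G θ (Z j ω) ≤ t then (1:ℝ) else 0)

/-- Distribution function `F_θ` of `G(θ,Z₁)`. -/
def trueDF {Ω : Type*} [MeasurableSpace Ω] {m d : ℕ} (P : Measure Ω)
    (G : Euc m → Euc d → ℝ) (Z : ℕ → Ω → Euc d) (θ : Euc m) (t : ℝ) : ℝ :=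
  (P {ω | G θ (Z 0 ω) ≤ t}).toReal

/-- Optimal value of the SAA problem: `inf_{θ∈Θ} 𝓡_{ρ^Φ}(F̂_{n,θ})`. -/
def empVal {Ω : Type*} {m d : ℕ} (Φs : ℝ → ℝ) (Θset : Set (Euc m))
    (G : Euc m → Euc d → ℝ) (Z : ℕ → Ω → Euc d) (n : ℕ) (ω : Ω) : ℝ :=
  sInf ((fun θ => RR Φs (empDF G Z θ n ω)) '' Θset)

/-- Optimal value of the genuine problem: `inf_{θ∈Θ} 𝓡_{ρ^Φ}(F_θ)`. -/
def trueVal {Ω : Type*} [MeasurableSpace Ω] {m d : ℕ} (Φs : ℝ → ℝ) (P : Measure Ω)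
    (Θset : Set (Euc m)) (G : Euc m → Euc d → ℝ) (Z : ℕ → Ω → Euc d) : ℝ :=
  sInf ((fun θ => RR Φs (trueDF P G Z θ)) '' Θset)

/-- `L²(Q)`-distance between two functions. -/
def L2dist {α : Type*} [MeasurableSpace α] (Q : Measure α) (f g : α → ℝ) : ℝ :=
  Real.sqrt (∫ z, (f z - g z) ^ 2 ∂Q)

/-- Probability measures with finite support (the class `𝓜_fin`). -/
def IsFiniteSupportProb {α : Type*} [MeasurableSpace α] (Q : Measure α) : Prop :=
  IsProbabilityMeasure Q ∧ ∃ s : Finset α, Q ((↑s : Set α)ᶜ) = 0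

/-- `N(ε,𝔽,L²(Q)) ≤ B`: the covering-number bound (centers in `𝔽`). -/
def CoverNumLE {α : Type*} [MeasurableSpace α] (Q : Measure α)
    (𝔽 : Set (α → ℝ)) (ε B : ℝ) : Prop :=
  ∃ T : Finset (α → ℝ), (↑T : Set (α → ℝ)) ⊆ 𝔽 ∧ ((T.card : ℝ) ≤ B) ∧
    ∀ f ∈ 𝔽, ∃ g ∈ T, L2dist Q f g < ε

/-- `N_[](ε,𝔽,L²(μ)) ≤ B`: the bracketing-number bound. -/
def BracketNumLE {α : Type*} [MeasurableSpace α] (μ : Measure α)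
    (𝔽 : Set (α → ℝ)) (ε B : ℝ) : Prop :=
  ∃ Brk : Finset ((α → ℝ) × (α → ℝ)), ((Brk.card : ℝ) ≤ B) ∧
    (∀ ψ ∈ Brk, MeasureTheory.Integrable (fun z => (ψ.1 z) ^ 2) μ ∧
      MeasureTheory.Integrable (fun z => (ψ.2 z) ^ 2) μ ∧ L2dist μ ψ.1 ψ.2 < ε) ∧
    ∀ f ∈ 𝔽, ∃ ψ ∈ Brk, ∀ z, ψ.1 z ≤ f z ∧ f z ≤ ψ.2 z

section Quantile

variable (μ : Measure ℝ)

lemma leftQuantile_cdf_le_iff {u : ℝ} (hu : u ∈ Ioo (0:ℝ) 1) (t : ℝ) :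
    leftQuantile (cdf μ) u ≤ t ↔ u ≤ cdf μ t := by
  have hbdd : BddBelow {t : ℝ | u ≤ cdf μ t} := by
    obtain ⟨a, ha⟩ := ((tendsto_cdf_atBot μ).eventually_lt_const hu.1).exists
    refine ⟨a, fun s hs => ?_⟩
    by_contra! h
    exact absurd (hs.trans (monotone_cdf μ h.le)) ha.not_ge
  have hne : {t : ℝ | u ≤ cdf μ t}.Nonempty := by
    obtain ⟨a, ha⟩ := ((tendsto_cdf_atTop μ).eventually_const_lt hu.2).exists
    exact ⟨a, ha.le⟩
  refine ⟨fun h => ?_, fun h => csInf_le hbdd h⟩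
  have hcont : Tendsto (cdf μ) (nhdsWithin t (Ioi t)) (nhds (cdf μ t)) :=
    ((cdf μ).right_continuous t).mono_left (nhdsWithin_mono _ Ioi_subset_Ici_self)
  refine ge_of_tendsto hcont ?_
  filter_upwards [self_mem_nhdsWithin] with s hs
  obtain ⟨r, hr, hrs⟩ := exists_lt_of_csInf_lt hne (lt_of_le_of_lt h hs)
  exact le_trans hr (monotone_cdf μ hrs.le)

lemma aemeasurable_leftQuantile_cdf :
    AEMeasurable (leftQuantile (cdf μ)) (volume.restrict (Ioo (0:ℝ) 1)) := by
  refine aemeasurable_restrict_of_monotoneOn measurableSet_Ioo fun u hu v hv huv => ?_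
  exact (leftQuantile_cdf_le_iff μ hu _).2
    (huv.trans ((leftQuantile_cdf_le_iff μ hv _).1 le_rfl))

/-- The quantile transform of the uniform distribution on `(0, 1)` has law `μ`. -/
lemma map_leftQuantile_cdf [IsProbabilityMeasure μ] :
    (volume.restrict (Ioo (0:ℝ) 1)).map (leftQuantile (cdf μ)) = μ := by
  have : IsProbabilityMeasure (volume.restrict (Ioo (0:ℝ) 1)) := ⟨by simp⟩
  have := Measure.isProbabilityMeasure_map (aemeasurable_leftQuantile_cdf μ)
  refine Measure.ext_of_Iic _ _ fun t => ?_
  rw [Measure.map_apply_of_aemeasurable (aemeasurable_leftQuantile_cdf μ) measurableSet_Iic,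
    Measure.restrict_apply' measurableSet_Ioo, ← ofReal_cdf μ t]
  have h1 : cdf μ t ≤ 1 := cdf_le_one μ t
  refine le_antisymm ?_ ?_
  · calc _ ≤ volume (Ioc 0 (cdf μ t)) :=
          measure_mono fun u hu => ⟨hu.2.1, (leftQuantile_cdf_le_iff μ hu.2 t).1 hu.1⟩
      _ = _ := by simp
  · have hsub : Ioo 0 (cdf μ t) ⊆ leftQuantile (cdf μ) ⁻¹' Iic t ∩ Ioo 0 1 := fun u hu =>
      have hu' : u ∈ Ioo (0:ℝ) 1 := ⟨hu.1, hu.2.trans_le h1⟩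
      ⟨(leftQuantile_cdf_le_iff μ hu' t).2 hu.2.le, hu'⟩
    calc _ = volume (Ioo 0 (cdf μ t)) := by simp
      _ ≤ _ := measure_mono hsub

end Quantile

lemma ocePhi_eq_integral {Ω : Type*} [MeasurableSpace Ω] (P : Measure Ω) [IsProbabilityMeasure P]
    {Φs : ℝ → ℝ} (hΦs : Measurable Φs) {X : Ω → ℝ} (hX : Measurable X) {F : ℝ → ℝ}
    (hF : ∀ t : ℝ, F t = (P {ω | X ω ≤ t}).toReal) (x : ℝ) :
    ocePhi Φs F x = (∫ ω, Φs (X ω + x) ∂P) - x := by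
  have := Measure.isProbabilityMeasure_map (μ := P) hX.aemeasurable
  have hFc : F = cdf (P.map X) := by
    ext t
    rw [cdf_eq_real, measureReal_def, Measure.map_apply hX measurableSet_Iic, hF]
    rfl
  have hm : Measurable fun y => Φs (y + x) := hΦs.comp (measurable_id.add_const x)
  rw [ocePhi, hFc, ← integral_map (aemeasurable_leftQuantile_cdf _) (f := fun y => Φs (y + x))
    hm.aestronglyMeasurable, map_leftQuantile_cdf, integral_map hX.aemeasurable
    hm.aestronglyMeasurable]

section Legendre

variable {Φ : ℝ → ℝ≥0∞} {Φs : ℝ → ℝ}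

lemma legendre_monotone
    (hΦs : ∀ y : ℝ, IsLUB {r : ℝ | ∃ x : ℝ, 0 ≤ x ∧ Φ x ≠ ⊤ ∧ r = x * y - (Φ x).toReal} (Φs y)) :
    Monotone Φs := by
  intro a b hab
  refine (hΦs a).2 ?_
  rintro r ⟨x, hx, hfin, rfl⟩
  have := (hΦs b).1 ⟨x, hx, hfin, rfl⟩
  nlinarith

lemma legendre_convexOn
    (hΦs : ∀ y : ℝ, IsLUB {r : ℝ | ∃ x : ℝ, 0 ≤ x ∧ Φ x ≠ ⊤ ∧ r = x * y - (Φ x).toReal} (Φs y)) :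
    ConvexOn ℝ univ Φs := by
  refine ⟨convex_univ, fun y _ z _ a b ha hb hab => (hΦs _).2 ?_⟩
  rintro r ⟨x, hx, hfin, rfl⟩
  have hy := mul_le_mul_of_nonneg_left ((hΦs y).1 ⟨x, hx, hfin, rfl⟩) ha
  have hz := mul_le_mul_of_nonneg_left ((hΦs z).1 ⟨x, hx, hfin, rfl⟩) hb
  have hc : (a + b) * (Φ x).toReal = (Φ x).toReal := by rw [hab, one_mul]
  simp only [smul_eq_mul]
  linarith

lemma legendre_nonneg (hΦzero : Φ 0 = 0)
    (hΦs : ∀ y : ℝ, IsLUB {r : ℝ | ∃ x : ℝ, 0 ≤ x ∧ Φ x ≠ ⊤ ∧ r = x * y - (Φ x).toReal} (Φs y))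
    (y : ℝ) : 0 ≤ Φs y :=
  (hΦs y).1 ⟨0, le_rfl, by simp [hΦzero], by simp [hΦzero]⟩

lemma legendre_eq_zero (hΦzero : Φ 0 = 0)
    (hΦs : ∀ y : ℝ, IsLUB {r : ℝ | ∃ x : ℝ, 0 ≤ x ∧ Φ x ≠ ⊤ ∧ r = x * y - (Φ x).toReal} (Φs y))
    {y : ℝ} (hy : y ≤ 0) : Φs y = 0 := by
  refine le_antisymm ((hΦs y).2 ?_) (legendre_nonneg hΦzero hΦs y)
  rintro r ⟨x, hx, -, rfl⟩
  have : 0 ≤ (Φ x).toReal := ENNReal.toReal_nonneg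
  nlinarith

end Legendre

section StrictConvex

variable {f : ℝ → ℝ}

/-- A convex function vanishing on `(-∞, 0]` satisfies the midpoint inequality strictly as soon as
the right end point is positive, provided it is strictly convex on `(0, ∞)`. -/
lemma midpoint_lt_of_strictConvexOn_Ioi (hconv : ConvexOn ℝ univ f) (hnonneg : ∀ y, 0 ≤ f y)
    (hzero : ∀ y ≤ 0, f y = 0) (hstrict : StrictConvexOn ℝ (Ioi 0) f) {a b : ℝ} (hab : a < b)
    (hb : 0 < b) : f ((a + b) / 2) < (f a + f b) / 2 := by
  have hconv_le := hconv.2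
  have hstrict_lt := hstrict.2
  have hscale : ∀ l : ℝ, 0 < l → l < 1 → f (l * b) < l * f b := by
    intro l hl hl1
    have hlb : 0 < l * b := mul_pos hl hb
    -- `l * b` lies strictly between `l * b / 2` and `b`
    have hd : 0 < 2 - l := by linarith
    have h1 := hstrict_lt (x := l * b / 2) (y := b) (a := 2 * (1 - l) / (2 - l)) (b := l / (2 - l))
      (by simp only [mem_Ioi]; linarith) hb (by nlinarith)
      (by apply div_pos <;> linarith) (by positivity) (by field_simp; ring)
    have h2 := hconv_le (x := 0) (y := b) (a := 1 - l / 2) (b := l / 2) trivial trivial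
      (by linarith) (by linarith) (by ring)
    simp only [smul_eq_mul, hzero 0 le_rfl, mul_zero, zero_add] at h1 h2
    have e1 : 2 * (1 - l) / (2 - l) * (l * b / 2) + l / (2 - l) * b = l * b := by
      field_simp; ring
    have e2 : l / 2 * b = l * b / 2 := by ring
    rw [e1] at h1
    rw [e2] at h2
    have hc : 0 ≤ 2 * (1 - l) / (2 - l) := by apply div_nonneg <;> linarith
    have h3 := mul_le_mul_of_nonneg_left h2 hc
    have e3 : 2 * (1 - l) / (2 - l) * (l / 2 * f b) + l / (2 - l) * f b = l * f b := by
      field_simp; ring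
    linarith
  rcases lt_or_ge 0 a with ha | ha
  · have := hstrict_lt (x := a) (y := b) (a := 1 / 2) (b := 1 / 2) ha hb hab.ne
      (by norm_num) (by norm_num) (by norm_num)
    simp only [smul_eq_mul] at this
    rw [show (a + b) / 2 = 1 / 2 * a + 1 / 2 * b by ring]
    linarith
  · rw [hzero a ha]
    have hhalf := hscale (1 / 2) (by norm_num) (by norm_num)
    have hle : f ((a + b) / 2) ≤ f (1 / 2 * b) := by
      rcases le_or_gt ((a + b) / 2) 0 with hm | hm
      · rw [hzero _ hm]
        exact hnonneg _
      · have hl : (a + b) / 2 / (1 / 2 * b) ≤ 1 := by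
          rw [div_le_one (by positivity)]; linarith
        have h := hconv_le (x := 0) (y := 1 / 2 * b)
          (a := 1 - (a + b) / 2 / (1 / 2 * b)) (b := (a + b) / 2 / (1 / 2 * b)) trivial trivial
          (by linarith) (by positivity) (by ring)
        simp only [smul_eq_mul, hzero 0 le_rfl, mul_zero, zero_add] at h
        rw [div_mul_cancel₀ _ (by positivity)] at h
        exact h.trans (mul_le_of_le_one_left (hnonneg _) hl)
    linarith

end StrictConvex

section Minimizer

variable {Ω : Type*} [MeasurableSpace Ω] {P : Measure Ω} [IsProbabilityMeasure P]
  {f : ℝ → ℝ} {X : Ω → ℝ}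

lemma integrable_comp_add_const (hmono : Monotone f) (hconv : ConvexOn ℝ univ f)
    (hnonneg : ∀ y, 0 ≤ f y) (hX : Measurable X)
    (hint : Integrable (fun ω => f (2 * |X ω|)) P) (x : ℝ) :
    Integrable (fun ω => f (X ω + x)) P := by
  refine ((hint.add (integrable_const (f (2 * |x|)))).div_const 2).mono'
    (hmono.measurable.comp (hX.add_const x)).aestronglyMeasurable (ae_of_all _ fun ω => ?_)
  have hconv_le := hconv.2
  rw [Real.norm_of_nonneg (hnonneg _)]
  have h1 : f (X ω + x) ≤ f (1 / 2 * (2 * |X ω|) + 1 / 2 * (2 * |x|)) :=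
    hmono (by linarith [le_abs_self (X ω), le_abs_self x])
  have h2 := hconv_le (x := 2 * |X ω|) (y := 2 * |x|) (a := 1 / 2) (b := 1 / 2) trivial trivial
    (by norm_num) (by norm_num) (by norm_num)
  simp only [smul_eq_mul] at h2
  simp only [Pi.add_apply]
  linarith

lemma integrable_of_affine_le (hX : Measurable X) {a c : ℝ} (ha : 0 < a)
    (haff : ∀ y, a * y - c ≤ f y) (hint : Integrable (fun ω => f (1 * |X ω|)) P) :
    Integrable X P := by
  refine ((hint.add (integrable_const c)).div_const a).mono' hX.aestronglyMeasurable
    (ae_of_all _ fun ω => ?_)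
  simp only [Pi.add_apply, one_mul, Real.norm_eq_abs]
  rw [le_div_iff₀ ha]
  linarith [haff |X ω|]

/-- Existence and uniqueness of the minimizer of the optimized certainty equivalent. -/
lemma existsUnique_minimizer_integral_sub (hconv : ConvexOn ℝ univ f) (hnonneg : ∀ y, 0 ≤ f y)
    (hzero : ∀ y ≤ 0, f y = 0) (hstrict : StrictConvexOn ℝ (Ioi 0) f)
    {a c : ℝ} (ha : 1 < a) (haff : ∀ y, a * y - c ≤ f y) (hX : Integrable X P)
    (hint : ∀ x, Integrable (fun ω => f (X ω + x)) P) :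
    ∃! x : ℝ, ∀ y : ℝ, (∫ ω, f (X ω + x) ∂P) - x ≤ (∫ ω, f (X ω + y) ∂P) - y := by
  set g : ℝ → ℝ := fun x => (∫ ω, f (X ω + x) ∂P) - x with hg
  have hconv_le := hconv.2
  have hgconv : ConvexOn ℝ univ g := by
    refine ⟨convex_univ, fun x _ y _ s t hs ht hst => ?_⟩
    have h : ∫ ω, f (X ω + (s * x + t * y)) ∂P
        ≤ ∫ ω, (s * f (X ω + x) + t * f (X ω + y)) ∂P := by
      refine integral_mono (hint _) (((hint x).const_mul s).add ((hint y).const_mul t)) fun ω => ?_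
      have := hconv_le (x := X ω + x) (y := X ω + y) trivial trivial hs ht hst
      simp only [smul_eq_mul] at this
      have e : X ω + (s * x + t * y) = s * (X ω + x) + t * (X ω + y) := by
        linear_combination (-X ω) * hst
      simpa only [e] using this
    rw [integral_add ((hint x).const_mul s) ((hint y).const_mul t), integral_const_mul,
      integral_const_mul] at h
    simp only [hg, smul_eq_mul]
    linarith
  have hgcont : Continuous g := continuousOn_univ.1 (hgconv.continuousOn isOpen_univ)
  have hlow1 : ∀ x, -x ≤ g x := fun x => by
    have : 0 ≤ ∫ ω, f (X ω + x) ∂P := integral_nonneg fun ω => hnonneg _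
    simp only [hg]; linarith
  have hlow2 : ∀ x, (a - 1) * x + (a * (∫ ω, X ω ∂P) - c) ≤ g x := fun x => by
    have h : ∫ ω, (a * X ω + (a * x - c)) ∂P ≤ ∫ ω, f (X ω + x) ∂P :=
      integral_mono ((hX.const_mul a).add (integrable_const _)) (hint x) fun ω => by
        have := haff (X ω + x)
        simp only
        linarith
    rw [integral_add (hX.const_mul a) (integrable_const _), integral_const_mul] at h
    simp only [integral_const, probReal_univ, one_smul] at h
    simp only [hg]; linarith
  have htop : Tendsto g atTop atTop :=
    tendsto_atTop_mono hlow2 (tendsto_atTop_add_const_right _ _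
      (tendsto_id.const_mul_atTop (by linarith)))
  have hbot : Tendsto g atBot atTop := tendsto_atTop_mono hlow1 tendsto_neg_atBot_atTop
  obtain ⟨m, hm⟩ : ∃ m, ∀ y, g m ≤ g y := by
    refine hgcont.exists_forall_le ?_
    rw [cocompact_eq_atBot_atTop]
    exact hbot.sup htop
  have huniq : ∀ x y, x < y → (∀ z, g x ≤ g z) → (∀ z, g y ≤ g z) → False := by
    intro x y hxy hx hy
    have hxy' : g x = g y := le_antisymm (hx y) (hy x)
    have hmid := hx ((x + y) / 2)
    set d : Ω → ℝ := fun ω => (f (X ω + x) + f (X ω + y)) / 2 - f (X ω + (x + y) / 2) with hd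
    have hid : Integrable d P := (((hint x).add (hint y)).div_const 2).sub (hint _)
    have hd0 : 0 ≤ d := fun ω => by
      have := hconv_le (x := X ω + x) (y := X ω + y) (a := 1 / 2) (b := 1 / 2) trivial trivial
        (by norm_num) (by norm_num) (by norm_num)
      simp only [smul_eq_mul] at this
      rw [show 1 / 2 * (X ω + x) + 1 / 2 * (X ω + y) = X ω + (x + y) / 2 by ring] at this
      simp only [hd, Pi.zero_apply]
      linarith
    have hdint : ∫ ω, d ω ∂P = 0 := by
      refine le_antisymm ?_ (integral_nonneg hd0)
      have e : ∫ ω, d ω ∂P = ((∫ ω, f (X ω + x) ∂P) + ∫ ω, f (X ω + y) ∂P) / 2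
          - ∫ ω, f (X ω + (x + y) / 2) ∂P := by
        rw [← integral_add (hint x) (hint y), ← integral_div]
        exact integral_sub (((hint x).add (hint y)).div_const 2) (hint _)
      simp only [hg] at hxy' hmid
      linarith
    have hae := (integral_eq_zero_iff_of_nonneg hd0 hid).1 hdint
    have hneg : ∀ᵐ ω ∂P, X ω + y ≤ 0 := by
      filter_upwards [hae] with ω hω
      by_contra! hpos
      have := midpoint_lt_of_strictConvexOn_Ioi hconv hnonneg hzero hstrict
        (a := X ω + x) (b := X ω + y) (by linarith) hpos
      rw [show (X ω + x + (X ω + y)) / 2 = X ω + (x + y) / 2 by ring] at this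
      simp only [hd, Pi.zero_apply] at hω
      linarith
    have hix : ∫ ω, f (X ω + x) ∂P = 0 := integral_eq_zero_of_ae <| by
      filter_upwards [hneg] with ω hω
      exact hzero _ (by linarith)
    have hiy : ∫ ω, f (X ω + y) ∂P = 0 := integral_eq_zero_of_ae <| by
      filter_upwards [hneg] with ω hω
      exact hzero _ hω
    simp only [hg, hix, hiy] at hxy'
    linarith
  refine ⟨m, hm, fun y hy => ?_⟩
  rcases lt_trichotomy y m with h | h | h
  · exact (huniq y m h hy hm).elim
  · exact h
  · exact (huniq m y h hm hy).elim

end Minimizer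

/-- **Uniqueness of the OCE minimizer** (Proposition `unique minimizer`).
If `Φ(0) = 0` and `Φ*` is strictly convex on `(0,∞)`, then for every
distribution function `F` of a random variable in the Orlicz heart the mapping
`x ↦ φ_{Φ*}(F,x)` has a unique minimizer. -/
theorem certainty_equivalent_unique_minimizer
    {Ω : Type*} [MeasurableSpace Ω] (P : Measure Ω) [IsProbabilityMeasure P]
    (hatomless : ∀ s : Set Ω, MeasurableSet s → 0 < P s →
      ∃ t, t ⊆ s ∧ MeasurableSet t ∧ 0 < P t ∧ P t < P s)
    -- Φ and its Fenchel-Legendre transform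
    (Φ : ℝ → ℝ≥0∞) (Φs : ℝ → ℝ)
    (hΦlsc : LowerSemicontinuous Φ)
    (hΦconv : ∀ x y a b : ℝ, 0 ≤ x → 0 ≤ y → 0 ≤ a → 0 ≤ b → a + b = 1 →
      Φ (a * x + b * y) ≤ ENNReal.ofReal a * Φ x + ENNReal.ofReal b * Φ y)
    (hΦ0 : Φ 0 ≠ ⊤)
    (hΦdom : ∃ x : ℝ, 1 < x ∧ Φ x ≠ ⊤)
    (hΦinf : sInf (Φ '' Set.Ici (0:ℝ)) = 0)
    (hΦgrow : ∀ c : ℝ, ∀ᶠ x : ℝ in Filter.atTop, ENNReal.ofReal (c * x) ≤ Φ x)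
    (hΦs : ∀ y : ℝ, IsLUB {r : ℝ | ∃ x : ℝ, 0 ≤ x ∧ Φ x ≠ ⊤ ∧ r = x * y - (Φ x).toReal} (Φs y))
    (hΦzero : Φ 0 = 0)
    (hΦsstrict : StrictConvexOn ℝ (Set.Ioi (0:ℝ)) Φs) :
    ∀ F : ℝ → ℝ,
      (∃ X : Ω → ℝ, Measurable X ∧
        (∀ c : ℝ, 0 < c → Integrable (fun ω => Φs (c * |X ω|)) P) ∧
        ∀ t : ℝ, F t = (P {ω | X ω ≤ t}).toReal) →
      ∃! x : ℝ, ∀ y : ℝ, ocePhi Φs F x ≤ ocePhi Φs F y := by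
  rintro F ⟨X, hX, hint, hF⟩
  have hmono := legendre_monotone hΦs
  have hconv := legendre_convexOn hΦs
  have hnonneg := legendre_nonneg hΦzero hΦs
  obtain ⟨a, ha, hfin⟩ := hΦdom
  have haff : ∀ y, a * y - (Φ a).toReal ≤ Φs y := fun y =>
    (hΦs y).1 ⟨a, by linarith, hfin, rfl⟩
  simp only [ocePhi_eq_integral P hmono.measurable hX hF]
  exact existsUnique_minimizer_integral_sub hconv hnonneg
    (fun y hy => legendre_eq_zero hΦzero hΦs hy) hΦsstrict ha haff
    (integrable_of_affine_le hX (by linarith) haff (hint 1 one_pos))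
    (integrable_comp_add_const hmono hconv hnonneg hX (hint 2 two_pos))
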